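/- arXiv:2308.13457 — 6 statements merged into one kernel-verified Lean document; each statement's English description precedes it below -/
import Mathlib

section
/- For all nonnegative integers m and n, the Lucas analogue of the super FiboCatalan number S{m,n} = {2m}!·{2n}!/({m}!·{n}!·{m+n}!) is a polynomial with nonnegative integer coefficients; that is, there exists a polynomial p in ℤ[s,t], all of whose coefficients are nonnegative, such that {2m}!·{2n}! = p·{m}!·{n}!·{m+n}!. -/
open MvPolynomial

/-- The Lucas polynomials in `ℤ[s,t]` (with `s = X 0`, `t = X 1`):
`{0} = 0`, `{1} = 1`, `{n} = s{n−1} + t{n−2}` for `n ≥ 2`. -/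
noncomputable def lucas : ℕ → MvPolynomial (Fin 2) ℤ
  | 0 => 0
  | 1 => 1
  | n + 2 => X 0 * lucas (n + 1) + X 1 * lucas n

/-- The Lucas factorial `{n}! = {n}{n−1}⋯{2}{1}`, with `{0}! = 1`. -/
noncomputable def lucasFact : ℕ → MvPolynomial (Fin 2) ℤ
  | 0 => 1
  | n + 1 => lucas (n + 1) * lucasFact n


lemma aux_cheb (n : ℕ) (x : ℝ) : (Polynomial.Chebyshev.U ℝ n).eval x =
    2 ^ n * ∏ k ∈ Finset.range n, (x - Real.cos ((k + 1) * Real.pi / (n + 1))) := by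
  have hr := Polynomial.Chebyshev.roots_U_real n
  have hnd := Polynomial.Chebyshev.roots_U_real_nodup n
  have hs : (Polynomial.Chebyshev.U ℝ n).roots = ((Finset.range n).val.map
     (fun k : ℕ => Real.cos ((k + 1) * Real.pi / (n + 1)))) := by
    rw [hr, Finset.image_val, Multiset.dedup_eq_self.2]
    exact hnd
  have h := Polynomial.C_leadingCoeff_mul_prod_multiset_X_sub_C (p := Polynomial.Chebyshev.U ℝ n)
    (by rw [hs, Polynomial.Chebyshev.natDegree_U_natCast]; simp)
  rw [← h, Polynomial.Chebyshev.leadingCoeff_U_natCast, hs, Multiset.map_map]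
  change Polynomial.eval x (_ * ∏ k ∈ Finset.range n, _) = _
  simp [Polynomial.eval_prod]

lemma aux_eval (n : ℕ) (s y : ℝ) (hy : y ≠ 0) :
    eval ![s, -y^2] (map (Int.castRingHom ℝ) (lucas (n+1))) =
      y ^ n * (Polynomial.Chebyshev.U ℝ n).eval (s / (2 * y)) := by
  induction n using Nat.twoStepInduction with
  | zero => simp [lucas]
  | one => simp [lucas]; field_simp
  | more n h1 h2 =>
    have := Polynomial.Chebyshev.U_add_two ℝ n
    push_cast
    rw [this, lucas]
    push_cast at h2
    simp only [map_add, map_mul, h1, h2, map_X, eval_X, Polynomial.eval_sub, Polynomial.eval_mul,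
      Polynomial.eval_X, Polynomial.eval_ofNat]
    simp
    field_simp
    ring

lemma aux_eval2 (n : ℕ) (s y : ℝ) (hy : y ≠ 0) :
    eval ![s, -y^2] (map (Int.castRingHom ℝ) (lucas (n+1))) =
      ∏ k ∈ Finset.range n, (s - 2 * y * Real.cos ((k + 1) * Real.pi / (n + 1))) := by
  rw [aux_eval n s y hy, aux_cheb, ← mul_assoc, ← mul_pow]
  nth_rw 1 [← Finset.card_range n]
  rw [← Finset.prod_const, ← Finset.prod_mul_distrib]
  refine Finset.prod_congr rfl fun k _ => ?_
  field_simp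

/-- real factors -/
noncomputable def lfac (x : ℚ) : MvPolynomial (Fin 2) ℝ :=
  if x = 1/2 then X 0 else X 0 ^ 2 + C (4 * Real.cos (x * Real.pi) ^ 2) * X 1

lemma aux_pair (n : ℕ) (hn : 0 < n) (g : ℕ → ℝ) (f : ℕ → ℝ)
    (h1 : ∀ k, 0 < k → 2 * k < n → f k = g k * g (n - k))
    (h2 : ∀ k, 2 * k = n → f k = g k) :
    ∏ k ∈ Finset.Ioo 0 n, g k = ∏ k ∈ Finset.Icc 1 (n/2), f k := by
  have e1 : Finset.Ioo 0 n = (Finset.Icc 1 (n/2)) ∪ (Finset.Ioo (n/2) n) := by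
    ext k; simp; omega
  have d1 : Disjoint (Finset.Icc 1 (n/2)) (Finset.Ioo (n/2) n) := by
    rw [Finset.disjoint_left]; intro k; simp; omega
  have e3 : ∏ k ∈ Finset.Ioo (n/2) n, g k
      = ∏ k ∈ Finset.Icc 1 (n/2), if 2 * k < n then g (n - k) else 1 := by
    rw [← Finset.prod_filter]
    refine Finset.prod_bij' (fun k _ => n - k) (fun k _ => n - k) ?_ ?_ ?_ ?_ ?_
    all_goals intro k hk; simp at hk
    · simp; omega
    · simp; omega
    · omega
    · omega
    · congr 1; omega
  rw [e1, Finset.prod_union d1, e3, ← Finset.prod_mul_distrib]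
  refine Finset.prod_congr rfl fun k hk => ?_
  simp at hk
  split_ifs with h
  · rw [h1 k (by omega) h]
  · rw [h2 k (by omega), mul_one]

lemma aux_factor (n : ℕ) (hn : 0 < n) :
    map (Int.castRingHom ℝ) (lucas n) = ∏ k ∈ Finset.Icc 1 (n/2), lfac ((k:ℚ) / n) := by
  have hn' : (n : ℝ) ≠ 0 := by positivity
  apply MvPolynomial.funext_set (![Set.univ, Set.Iio 0])
  · intro i
    fin_cases i
    · exact Set.infinite_univ
    · exact Set.Iio_infinite 0
  · intro x hx
    have hx1 : x 1 < 0 := by simpa using hx 1 (Set.mem_univ _)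
    obtain ⟨y, hy, hxy⟩ : ∃ y : ℝ, y ≠ 0 ∧ x 1 = - y^2 :=
      ⟨Real.sqrt (- x 1), (Real.sqrt_pos.2 (by linarith)).ne', by
        rw [Real.sq_sqrt (by linarith)]; ring⟩
    have hxe : x = ![x 0, -y^2] := by
      ext i; fin_cases i
      · rfl
      · exact hxy
    rw [hxe]
    generalize x 0 = s
    rw [map_prod, ← aux_pair n hn (fun k => s - 2 * y * Real.cos (k * Real.pi / n))]
    · obtain ⟨N, rfl⟩ : ∃ N, n = N + 1 := ⟨n - 1, by omega⟩
      rw [aux_eval2 N s y hy]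
      refine Finset.prod_bij' (fun k _ => k + 1) (fun k _ => k - 1) ?_ ?_ ?_ ?_ ?_
      all_goals intro k hk; simp at hk
      · simp; omega
      · simp; omega
      · simp
      · omega
      · push_cast; rfl
    · intro k hk hkn
      have hne : (k:ℚ)/n ≠ 1/2 := by
        intro h
        rw [div_eq_div_iff (by positivity) (by norm_num)] at h
        norm_cast at h; omega
      have hc : Real.cos (((n - k : ℕ):ℝ) * Real.pi / n) = - Real.cos (k * Real.pi / n) := by
        rw [← Real.cos_pi_sub]; congr 1
        rw [Nat.cast_sub (by omega)]; field_simp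
      have hc2 : ((k:ℝ) / n * Real.pi) = k * Real.pi / n := by ring
      rw [hc, lfac, if_neg hne]
      simp [hc2]
      ring
    · intro k hk
      have hne : (k:ℚ)/n = 1/2 := by
        rw [div_eq_div_iff (by positivity) (by norm_num)]
        norm_cast; omega
      have hc : (k:ℝ) * Real.pi / n = Real.pi / 2 := by
        rw [← hk]; rw [← hk] at hn'; push_cast at hn' ⊢
        have hk0 : (k:ℝ) ≠ 0 := fun h => hn' (by rw [h, mul_zero])
        field_simp
      rw [lfac, if_pos hne, hc]
      simp

noncomputable def lset (M : ℕ) : Finset ℚ :=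
  ((Finset.Icc 1 M ×ˢ Finset.Icc 1 M).image (fun p => (p.1 : ℚ) / p.2)).filter
    (fun x => x ≤ 1/2)

lemma aux_set (M n : ℕ) (hn : 0 < n) (hM : n ≤ M) :
    map (Int.castRingHom ℝ) (lucas n) = ∏ x ∈ (lset M).filter (fun x => x.den ∣ n), lfac x := by
  have hn' : (n : ℚ) ≠ 0 := by positivity
  rw [aux_factor n hn]
  refine Finset.prod_bij (fun k _ => (k:ℚ) / n) ?_ ?_ ?_ ?_
  · intro k hk
    simp only [Finset.mem_Icc] at hk
    simp only [lset, Finset.mem_filter, Finset.mem_image, Finset.mem_product, Finset.mem_Icc]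
    refine ⟨⟨⟨(k, n), by simp; omega, rfl⟩, ?_⟩, ?_⟩
    · rw [div_le_div_iff₀ (by positivity) (by norm_num)]
      norm_cast; omega
    · have := Rat.den_dvd (k:ℤ) n
      rw [Rat.divInt_eq_div] at this
      exact_mod_cast this
  · intro a _ b _ h
    field_simp at h
    exact_mod_cast h
  · intro x hx
    simp only [lset, Finset.mem_filter, Finset.mem_image, Finset.mem_product, Finset.mem_Icc] at hx
    obtain ⟨⟨⟨⟨a, b⟩, hab, rfl⟩, hle⟩, c, hc⟩ := hx
    simp only at hab hle hc ⊢
    set x : ℚ := (a:ℚ)/b with hxd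
    have hpos : 0 < x := by
      have : 0 < a := by omega
      have : 0 < b := by omega
      positivity
    have hnum : 0 < x.num := Rat.num_pos.2 hpos
    have hc0 : 0 < c := Nat.pos_of_ne_zero (by rintro rfl; omega)
    have e : ((x.num.toNat * c : ℕ) : ℚ) / n = x := by
      have h1 : ((x.num.toNat : ℕ) : ℚ) = (x.num : ℚ) := by
        exact_mod_cast (congrArg (Int.cast : ℤ → ℚ) (Int.toNat_of_nonneg hnum.le))
      have h2 : (x.den : ℚ) ≠ 0 := by exact_mod_cast x.den_nz
      have h3 : (c : ℚ) ≠ 0 := by positivity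
      have h4 : x * x.den = x.num := Rat.mul_den_eq_num x
      rw [hc]; push_cast
      rw [h1, ← h4]; field_simp
    refine ⟨x.num.toNat * c, ?_, e⟩
    rw [← e, div_le_div_iff₀ (by positivity) (by norm_num)] at hle
    norm_cast at hle
    have : 0 < x.num.toNat * c := Nat.mul_pos (by omega) hc0
    simp; omega
  · intros; rfl

lemma aux_fact (M N : ℕ) (hM : N ≤ M) :
    map (Int.castRingHom ℝ) (lucasFact N) = ∏ x ∈ lset M, lfac x ^ (N / x.den) := by
  induction N with
  | zero => simp [lucasFact]
  | succ N ih =>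
    rw [lucasFact, map_mul, ih (by omega), aux_set M (N+1) (by omega) hM, Finset.prod_filter,
      ← Finset.prod_mul_distrib]
    refine Finset.prod_congr rfl fun x _ => ?_
    rw [Nat.succ_div]
    split_ifs
    · rw [pow_succ]; ring
    · simp

lemma aux_floor (m n d : ℕ) (hd : 0 < d) :
    m / d + n / d + (m + n) / d ≤ 2 * m / d + 2 * n / d := by
  have h1 := Nat.div_add_mod m d
  have h2 := Nat.div_add_mod n d
  have l1 := Nat.mod_lt m hd
  have l2 := Nat.mod_lt n hd
  generalize m / d = a at *
  generalize n / d = b at *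
  generalize m % d = r at *
  generalize n % d = t at *
  have e1 : (m + n) / d = a + b + (r + t) / d := by
    rw [← h1, ← h2, show d * a + r + (d * b + t) = (r + t) + d * (a + b) by ring,
      Nat.add_mul_div_left _ _ hd]; ring
  have e2 : 2 * m / d = 2 * a + 2 * r / d := by
    rw [← h1, show 2 * (d * a + r) = 2 * r + d * (2 * a) by ring,
      Nat.add_mul_div_left _ _ hd]; ring
  have e3 : 2 * n / d = 2 * b + 2 * t / d := by
    rw [← h2, show 2 * (d * b + t) = 2 * t + d * (2 * b) by ring,
      Nat.add_mul_div_left _ _ hd]; ring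
  have key : (r + t) / d ≤ 2 * r / d + 2 * t / d := by
    rcases le_total r t with h | h
    · exact (Nat.div_le_div_right (by omega : r + t ≤ 2 * t)).trans (Nat.le_add_left _ _)
    · exact (Nat.div_le_div_right (by omega : r + t ≤ 2 * r)).trans (Nat.le_add_right _ _)
  omega

def NN (p : MvPolynomial (Fin 2) ℝ) : Prop := ∀ d, 0 ≤ p.coeff d

lemma NN.mul {p q : MvPolynomial (Fin 2) ℝ} (hp : NN p) (hq : NN q) : NN (p * q) := by
  intro d
  rw [coeff_mul]
  exact Finset.sum_nonneg fun x _ => mul_nonneg (hp _) (hq _)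

lemma NN.one : NN 1 := by
  intro d; rw [coeff_one]; split_ifs <;> norm_num

lemma NN.X (i : Fin 2) : NN (X i) := by
  intro d; rw [coeff_X]; split_ifs <;> norm_num

lemma NN.pow {p : MvPolynomial (Fin 2) ℝ} (hp : NN p) (k : ℕ) : NN (p ^ k) := by
  induction k with
  | zero => simpa using NN.one
  | succ k ih => rw [pow_succ]; exact ih.mul hp

lemma NN.prod {ι : Type*} (s : Finset ι) (f : ι → MvPolynomial (Fin 2) ℝ)
    (h : ∀ i ∈ s, NN (f i)) : NN (∏ i ∈ s, f i) :=
  Finset.prod_induction f NN (fun _ _ => NN.mul) NN.one h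

lemma NN.lfac (x : ℚ) : NN (lfac x) := by
  unfold _root_.lfac
  split_ifs
  · exact NN.X 0
  · intro d
    rw [coeff_add, coeff_C_mul]
    exact add_nonneg ((NN.X 0).pow 2 d) (mul_nonneg (by positivity) (NN.X 1 d))

lemma monic_lucas (n : ℕ) : (finSuccEquiv ℤ 1 (lucas (n+1))).Monic ∧
    (finSuccEquiv ℤ 1 (lucas (n+1))).natDegree = n := by
  induction n using Nat.twoStepInduction with
  | zero => simp [lucas]
  | one =>
    simp only [lucas, mul_one, mul_zero, add_zero, finSuccEquiv_X_zero]
    exact ⟨Polynomial.monic_X, Polynomial.natDegree_X⟩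
  | more n h1 h2 =>
    rw [lucas, map_add, map_mul, map_mul, finSuccEquiv_X_zero,
      show (X 1 : MvPolynomial (Fin 2) ℤ) = X (Fin.succ 0) from rfl, finSuccEquiv_X_succ]
    have hm := Polynomial.monic_X.mul h2.1
    have hd : (Polynomial.X * finSuccEquiv ℤ 1 (lucas (n+1+1))).natDegree = n + 2 := by
      rw [Polynomial.monic_X.natDegree_mul h2.1, h2.2, Polynomial.natDegree_X]; ring
    have hlt : (Polynomial.C (X 0 : MvPolynomial (Fin 1) ℤ) * finSuccEquiv ℤ 1 (lucas (n+1))).degree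
        < (Polynomial.X * finSuccEquiv ℤ 1 (lucas (n+1+1))).degree := by
      rw [Polynomial.degree_eq_natDegree hm.ne_zero, hd]
      rw [Polynomial.degree_C_mul (MvPolynomial.X_ne_zero 0)]
      rw [Polynomial.degree_eq_natDegree h1.1.ne_zero, h1.2]
      exact_mod_cast (by omega : n < n + 2)
    exact ⟨hm.add_of_left hlt, by
      rw [Polynomial.natDegree_add_eq_left_of_degree_lt hlt, hd]⟩

lemma monic_fact (n : ℕ) : (finSuccEquiv ℤ 1 (lucasFact n)).Monic := by
  induction n with
  | zero => simp [lucasFact]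
  | succ n ih => rw [lucasFact, map_mul]; exact (monic_lucas n).1.mul ih

lemma fse_map (p : MvPolynomial (Fin 2) ℤ) :
    finSuccEquiv ℝ 1 (map (Int.castRingHom ℝ) p) =
      (finSuccEquiv ℤ 1 p).map (map (Int.castRingHom ℝ)) := by
  induction p using MvPolynomial.induction_on with
  | C a => simp [finSuccEquiv_apply]
  | add p q hp hq => simp only [map_add, Polynomial.map_add, hp, hq]
  | mul_X p i hp =>
    simp only [map_mul, Polynomial.map_mul, hp, map_X]
    congr 1
    refine Fin.cases ?_ (fun j => ?_) i
    · simp only [finSuccEquiv_X_zero, Polynomial.map_X]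
    · simp only [finSuccEquiv_X_succ, Polynomial.map_C, map_X]

theorem lucas_superFiboCatalan_poly (m n : ℕ) :
    ∃ p : MvPolynomial (Fin 2) ℤ, (∀ d, 0 ≤ p.coeff d) ∧
      lucasFact (2 * m) * lucasFact (2 * n)
        = p * (lucasFact m * lucasFact n * lucasFact (m + n)) := by
  have hinj : Function.Injective (Int.castRingHom ℝ) := Int.cast_injective
  set D := lucasFact m * lucasFact n * lucasFact (m + n) with hD
  set N := lucasFact (2 * m) * lucasFact (2 * n) with hN
  have hDm : (finSuccEquiv ℤ 1 D).Monic := by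
    rw [hD, map_mul, map_mul]
    exact ((monic_fact m).mul (monic_fact n)).mul (monic_fact _)
  obtain ⟨q, hq, hNq⟩ : ∃ q : MvPolynomial (Fin 2) ℝ, NN q ∧
      map (Int.castRingHom ℝ) N = map (Int.castRingHom ℝ) D * q := by
    refine ⟨∏ x ∈ lset (2 * m + 2 * n), lfac x ^ ((2 * m / x.den + 2 * n / x.den) -
      (m / x.den + n / x.den + (m + n) / x.den)),
      NN.prod _ _ fun x _ => (NN.lfac x).pow _, ?_⟩
    rw [hD, hN]
    simp only [map_mul]
    rw [aux_fact (2 * m + 2 * n) (2 * m) (by omega), aux_fact (2 * m + 2 * n) (2 * n) (by omega),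
      aux_fact (2 * m + 2 * n) m (by omega), aux_fact (2 * m + 2 * n) n (by omega),
      aux_fact (2 * m + 2 * n) (m + n) (by omega)]
    simp only [← Finset.prod_mul_distrib]
    refine Finset.prod_congr rfl fun x _ => ?_
    simp only [← pow_add]
    congr 1
    have := aux_floor m n x.den x.den_pos
    omega
  have hdvd : finSuccEquiv ℤ 1 D ∣ finSuccEquiv ℤ 1 N := by
    rw [← Polynomial.map_dvd_map (map (Int.castRingHom ℝ)) (map_injective _ hinj) hDm,
      ← fse_map, ← fse_map, hNq]
    exact map_dvd (finSuccEquiv ℝ 1) (Dvd.intro _ rfl)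
  obtain ⟨p, hp⟩ := (map_dvd_iff (finSuccEquiv ℤ 1)).1 hdvd
  refine ⟨p, ?_, by rw [hp, mul_comm]⟩
  have hD0 : D ≠ 0 := by
    intro h; rw [h, map_zero] at hDm; exact hDm.ne_zero rfl
  have hpq : map (Int.castRingHom ℝ) p = q := by
    rw [hp, map_mul] at hNq
    refine mul_left_cancel₀ ?_ hNq
    intro h
    exact hD0 (map_injective _ hinj (by rw [h, map_zero]))
  intro d
  have := hq d
  rw [← hpq, coeff_map] at this
  simpa using this
end

section
/- For all nonnegative integers m and n, the super FiboCatalan number S(m,n)_F = F_{2m}!·F_{2n}!/(F_m!·F_n!·F_{m+n}!) is a positive integer; that is, F_m!·F_n!·F_{m+n}! divides F_{2m}!·F_{2n}!. -/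
/-- The Fibonacci factorial `F_n! = F_n F_{n-1} ⋯ F_2 F_1`, with `F_0! = 1`. -/
def fibFact : ℕ → ℕ
  | 0 => 1
  | n + 1 => Nat.fib (n + 1) * fibFact n

lemma floor_ineq (r m n : ℕ) : m / r + n / r + (m + n) / r ≤ 2 * m / r + 2 * n / r := by
  rcases Nat.eq_zero_or_pos r with rfl | hr
  · simp
  obtain ⟨a, s, hs, rfl⟩ : ∃ a s, s < r ∧ m = r * a + s :=
    ⟨m / r, m % r, Nat.mod_lt _ hr, (Nat.div_add_mod m r).symm⟩
  obtain ⟨b, t, ht, rfl⟩ : ∃ a s, s < r ∧ n = r * a + s :=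
    ⟨n / r, n % r, Nat.mod_lt _ hr, (Nat.div_add_mod n r).symm⟩
  have e1 : r * a + s + (r * b + t) = r * (a + b) + (s + t) := by ring
  have e2 : 2 * (r * a + s) = r * (2 * a) + 2 * s := by ring
  have e3 : 2 * (r * b + t) = r * (2 * b) + 2 * t := by ring
  rw [e1, e2, e3]
  simp only [Nat.mul_add_div hr, Nat.div_eq_of_lt hs, Nat.div_eq_of_lt ht]
  have h : (s + t) / r ≤ 2 * s / r + 2 * t / r := by
    have : (s + t) / r ≤ 2 * s / r ∨ (s + t) / r ≤ 2 * t / r := by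
      rcases le_total s t with h | h
      · right; exact Nat.div_le_div_right (by omega)
      · left; exact Nat.div_le_div_right (by omega)
    rcases this with h | h
    · exact h.trans (Nat.le_add_right _ _)
    · exact h.trans (Nat.le_add_left _ _)
  generalize (s + t) / r = x at *
  generalize 2 * s / r = y at *
  generalize 2 * t / r = z at *
  clear e1 e2 e3
  omega

lemma exists_rank (d : ℕ) : ∃ r, ∀ j, 0 < j → (d ∣ Nat.fib j ↔ r ∣ j) := by
  classical
  by_cases h : ∃ r, 0 < r ∧ d ∣ Nat.fib r
  · refine ⟨Nat.find h, fun j hj => ⟨fun hd => ?_, fun hd => ?_⟩⟩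
    · have h1 := Nat.find_spec h
      have h2 : d ∣ Nat.fib (Nat.gcd (Nat.find h) j) := by
        rw [Nat.fib_gcd]; exact Nat.dvd_gcd h1.2 hd
      have h3 := Nat.find_min' h ⟨Nat.gcd_pos_of_pos_right _ hj, h2⟩
      have h4 := Nat.gcd_le_left j h1.1
      have h5 : Nat.gcd (Nat.find h) j = Nat.find h := le_antisymm h4 h3
      exact Nat.gcd_eq_left_iff_dvd.mp h5
    · exact (Nat.find_spec h).2.trans (Nat.fib_dvd _ _ hd)
  · refine ⟨0, fun j hj => ⟨fun hd => (h ⟨j, hj, hd⟩).elim, fun hd => ?_⟩⟩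
    rw [zero_dvd_iff] at hd
    omega

lemma fibFact_pos (n : ℕ) : fibFact n ≠ 0 := by
  induction n with
  | zero => simp [fibFact]
  | succ n ih => simp [fibFact, ih]

lemma fibFact_fac (p : ℕ) (hp : p.Prime) (r : ℕ → ℕ)
    (hr : ∀ i j, 0 < j → (p ^ i ∣ Nat.fib j ↔ r i ∣ j)) (b n : ℕ) (hb : Nat.fib n ≤ b) :
    (fibFact n).factorization p = ∑ i ∈ Finset.Ico 1 (b + 1), n / r i := by
  induction n with
  | zero => simp [fibFact]
  | succ n ih =>
    have hb' : Nat.fib n ≤ b := Nat.fib_le_fib_succ.trans hb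
    have hf : Nat.fib (n + 1) ≠ 0 := by simp
    rw [fibFact, Nat.factorization_mul hf (fibFact_pos n), Finsupp.add_apply, ih hb',
      Nat.factorization_eq_card_pow_dvd_of_lt hp (b := b + 1) (Nat.pos_of_ne_zero hf)
        (lt_of_le_of_lt (hb.trans (Nat.le_succ b)) (Nat.lt_pow_self hp.one_lt)),
      Finset.card_filter, ← Finset.sum_add_distrib]
    refine Finset.sum_congr rfl fun i _ => ?_
    rw [Nat.succ_div, add_comm]
    simp only [hr i (n + 1) (Nat.succ_pos n)]

/-- The super FiboCatalan number `S(m,n)_F = F_{2m}!·F_{2n}!/(F_m!·F_n!·F_{m+n}!)` is a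
positive integer: `F_m!·F_n!·F_{m+n}!` divides `F_{2m}!·F_{2n}!`. -/
theorem superFiboCatalan_int (m n : ℕ) :
    fibFact m * fibFact n * fibFact (m + n) ∣ fibFact (2 * m) * fibFact (2 * n) := by
  have h0 := fibFact_pos
  rw [← Nat.factorization_prime_le_iff_dvd
    (mul_ne_zero (mul_ne_zero (h0 _) (h0 _)) (h0 _)) (mul_ne_zero (h0 _) (h0 _))]
  intro p hp
  choose r hr using fun i => exists_rank (p ^ i)
  have key : ∀ k ≤ 2 * (m + n), (fibFact k).factorization p =
      ∑ i ∈ Finset.Ico 1 (Nat.fib (2 * (m + n)) + 1), k / r i :=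
    fun k hk => fibFact_fac p hp r hr _ k (Nat.fib_mono hk)
  rw [Nat.factorization_mul (mul_ne_zero (h0 _) (h0 _)) (h0 _),
    Nat.factorization_mul (h0 _) (h0 _), Nat.factorization_mul (h0 _) (h0 _)]
  simp only [Finsupp.add_apply]
  rw [key m (by omega), key n (by omega), key (m + n) (by omega), key (2 * m) (by omega),
    key (2 * n) (by omega)]
  simp only [← Finset.sum_add_distrib]
  exact Finset.sum_le_sum fun i _ => floor_ineq _ _ _
end

section
/- For every integer n ≥ 1, the following identity of rational numbers holds: F_{2n+1}·F_{2n}·C_{n,F} − F_{n+1}·F_n·C_{n+1,F} = (−1)^n·F_n·F_{2n+1}·F_{2n}!/(F_{n+2}!·F_n!) = (−1)^n·binom(2n+1, n+2)_F. -/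
/-- The fibonomial coefficient `binom(n,k)_F = F_n!/(F_k!·F_{n−k}!)`, as a rational number. -/
noncomputable def fibinom (n k : ℕ) : ℚ :=
  (fibFact n : ℚ) / ((fibFact k : ℚ) * (fibFact (n - k) : ℚ))

/-- The FiboCatalan number `C_{n,F} = F_{2n}!/(F_{n+1}!·F_n!)`, as a rational number. -/
noncomputable def fiboCatalan (n : ℕ) : ℚ :=
  (fibFact (2 * n) : ℚ) / ((fibFact (n + 1) : ℚ) * (fibFact n : ℚ))

theorem fibFact_pos_aux (n : ℕ) : 0 < fibFact n := by
  induction n with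
  | zero => simp [fibFact]
  | succ k ih => exact Nat.mul_pos (Nat.fib_pos.2 (Nat.succ_pos k)) ih

theorem cassini_aux (n : ℕ) : (Nat.fib (n+1) : ℚ)^2 - Nat.fib n * Nat.fib (n+1)
    - (Nat.fib n : ℚ)^2 = (-1)^n := by
  induction n with
  | zero => simp
  | succ k ih =>
    rw [Nat.fib_add_two, pow_succ (-1 : ℚ) k, ← ih]
    push_cast
    ring

theorem fib_two_mul_aux (n : ℕ) : (Nat.fib (2*n) : ℚ)
    = Nat.fib n * (2 * Nat.fib (n+1) - Nat.fib n) := by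
  have h : Nat.fib n ≤ 2 * Nat.fib (n+1) := by
    have := Nat.fib_le_fib_succ (n := n)
    omega
  rw [Nat.fib_two_mul]
  push_cast [Nat.cast_sub h]
  ring

/-- For `n ≥ 1`:
`F_{2n+1}·F_{2n}·C_{n,F} − F_{n+1}·F_n·C_{n+1,F}
  = (−1)^n·F_n·F_{2n+1}·F_{2n}!/(F_{n+2}!·F_n!) = (−1)^n·binom(2n+1,n+2)_F`. -/
theorem fiboCatalan_identity (n : ℕ) (hn : 1 ≤ n) :
    (Nat.fib (2 * n + 1) : ℚ) * (Nat.fib (2 * n) : ℚ) * fiboCatalan n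
        - (Nat.fib (n + 1) : ℚ) * (Nat.fib n : ℚ) * fiboCatalan (n + 1)
      = (-1 : ℚ) ^ n * (Nat.fib n : ℚ) * (Nat.fib (2 * n + 1) : ℚ) * (fibFact (2 * n) : ℚ)
          / ((fibFact (n + 2) : ℚ) * (fibFact n : ℚ)) ∧
    (-1 : ℚ) ^ n * (Nat.fib n : ℚ) * (Nat.fib (2 * n + 1) : ℚ) * (fibFact (2 * n) : ℚ)
        / ((fibFact (n + 2) : ℚ) * (fibFact n : ℚ))
      = (-1 : ℚ) ^ n * fibinom (2 * n + 1) (n + 2) := by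
  have hA : (fibFact n : ℚ) ≠ 0 := by exact_mod_cast (fibFact_pos_aux n).ne'
  have ha : (Nat.fib n : ℚ) ≠ 0 := by exact_mod_cast (Nat.fib_pos.2 hn).ne'
  have hb : (Nat.fib (n+1) : ℚ) ≠ 0 := by exact_mod_cast (Nat.fib_pos.2 (Nat.succ_pos n)).ne'
  have hc : (Nat.fib (n+2) : ℚ) ≠ 0 := by
    exact_mod_cast (Nat.fib_pos.2 (Nat.succ_pos (n+1))).ne'
  have e1 : (fibFact (n+1) : ℚ) = Nat.fib (n+1) * fibFact n := by simp [fibFact]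
  have e2 : (fibFact (n+2) : ℚ) = Nat.fib (n+2) * (Nat.fib (n+1) * fibFact n) := by
    simp [fibFact]
  have e3 : (fibFact (2*n+1) : ℚ) = Nat.fib (2*n+1) * fibFact (2*n) := by simp [fibFact]
  have e4 : (fibFact (2*(n+1)) : ℚ)
      = Nat.fib (2*(n+1)) * (Nat.fib (2*n+1) * fibFact (2*n)) := by
    simp [fibFact, Nat.mul_add]
  have hcc : (Nat.fib (n+2) : ℚ) = Nat.fib n + Nat.fib (n+1) := by
    rw [Nat.fib_add_two]; push_cast; ring
  have key : (Nat.fib (2*n) : ℚ) * Nat.fib (n+2) - Nat.fib n * Nat.fib (2*(n+1))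
      = (-1)^n * Nat.fib n := by
    rw [fib_two_mul_aux, fib_two_mul_aux, ← cassini_aux, show n+1+1 = n+2 from rfl, hcc]
    ring
  constructor
  · unfold fiboCatalan
    rw [show n+1+1 = n+2 from rfl, e4, e2, e1]
    rw [mul_assoc ((-1 : ℚ)^n * _), ← key]
    field_simp
  · unfold fibinom
    obtain ⟨m, rfl⟩ : ∃ m, n = m+1 := ⟨n-1, by omega⟩
    have hB : (fibFact m : ℚ) ≠ 0 := by exact_mod_cast (fibFact_pos_aux m).ne'
    have hd : (fibFact (m+1+2) : ℚ) ≠ 0 := by exact_mod_cast (fibFact_pos_aux (m+1+2)).ne'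
    have e5 : (fibFact (m+1) : ℚ) = Nat.fib (m+1) * fibFact m := by simp [fibFact]
    rw [show 2*(m+1)+1-(m+1+2) = m by omega, e3, e5]
    field_simp
end

section
/- For every integer n ≥ 1, if gcd(2n+1, n+2) = 1 then F_{n+2} divides the FiboCatalan number C_{n,F}; that is, F_{n+2}·F_{n+1}!·F_n! divides F_{2n}!. -/
theorem fibFact_mul_dvd (a : ℕ) : ∀ b : ℕ, fibFact a * fibFact b ∣ fibFact (a + b) := by
  induction a with
  | zero => intro b; simp [fibFact]
  | succ a iha =>
    intro b
    induction b with
    | zero => simp [fibFact]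
    | succ b ihb =>
      have e : fibFact (a + 1 + (b + 1)) = Nat.fib (a + 1) * Nat.fib b * fibFact (a + 1 + b)
          + Nat.fib (a + 2) * Nat.fib (b + 1) * fibFact (a + 1 + b) := by
        have := Nat.fib_add (a + 1) b
        show Nat.fib (a + 1 + b + 1) * fibFact (a + 1 + b) = _
        rw [this]; ring
      rw [e]
      apply dvd_add
      · have h1 := iha (b + 1)
        have h2 : fibFact (a + 1) * fibFact (b + 1)
            = Nat.fib (a + 1) * (fibFact a * fibFact (b + 1)) := by
          simp only [fibFact]; ring
        rw [h2, mul_assoc]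
        apply mul_dvd_mul_left
        rw [show a + 1 + b = a + (b + 1) by ring]
        exact Dvd.dvd.mul_left h1 _
      · have h2 : fibFact (a + 1) * fibFact (b + 1)
            = Nat.fib (b + 1) * (fibFact (a + 1) * fibFact b) := by
          simp only [fibFact]; ring
        rw [h2, mul_comm (Nat.fib (a + 2)), mul_assoc]
        apply mul_dvd_mul_left
        exact Dvd.dvd.mul_left ihb _

theorem dvd_of_two_mul {d x y t : ℕ} (hc : Nat.Coprime x y) (hx : d ∣ x * t) (hy : d ∣ y * t) :
    d ∣ t := by
  have := Nat.dvd_gcd hx hy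
  rwa [Nat.gcd_mul_right, hc, one_mul] at this

/-- For `n ≥ 1`, if `gcd (2n+1) (n+2) = 1` then `F_{n+2}` divides the FiboCatalan number
`C_{n,F} = F_{2n}!/(F_{n+1}!·F_n!)`: `F_{n+2}·F_{n+1}!·F_n!` divides `F_{2n}!`. -/
theorem fib_dvd_fiboCatalan (n : ℕ) (hn : 1 ≤ n)
    (h : Nat.gcd (2 * n + 1) (n + 2) = 1) :
    Nat.fib (n + 2) * fibFact (n + 1) * fibFact n ∣ fibFact (2 * n) := by
  obtain ⟨m, rfl⟩ : ∃ m, n = m + 1 := ⟨n - 1, by omega⟩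
  have f1 := fibFact_mul_dvd (m + 1) (m + 1)
  have f2 := fibFact_mul_dvd (m + 2) m
  have f3 := fibFact_mul_dvd (m + 3) m
  rw [show m + 1 + (m + 1) = 2 * (m + 1) by ring] at f1
  rw [show m + 2 + m = 2 * (m + 1) by ring] at f2
  rw [show m + 3 + m = 2 * (m + 1) + 1 by ring] at f3
  have e3 : fibFact (2 * (m + 1) + 1) = Nat.fib (2 * (m + 1) + 1) * fibFact (2 * (m + 1)) := rfl
  rw [e3] at f3
  have s1 : fibFact (m + 1) = Nat.fib (m + 1) * fibFact m := rfl
  have s2 : fibFact (m + 2) = Nat.fib (m + 2) * fibFact (m + 1) := rfl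
  have s3 : fibFact (m + 3) = Nat.fib (m + 3) * fibFact (m + 2) := rfl
  have hD : fibFact (m + 2) * fibFact (m + 1) ∣ fibFact (2 * (m + 1)) := by
    apply dvd_of_two_mul (Nat.fib_coprime_fib_succ (m + 1))
    · have := mul_dvd_mul_left (Nat.fib (m + 1)) f2
      rwa [mul_left_comm, ← s1] at this
    · have := mul_dvd_mul_left (Nat.fib (m + 2)) f1
      rwa [← mul_assoc, ← s2] at this
  have c1 : Nat.Coprime (Nat.fib (2 * (m + 1) + 1)) (Nat.fib (m + 3)) := by
    have := Nat.fib_gcd (2 * (m + 1) + 1) (m + 3)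
    rw [show m + 3 = m + 1 + 2 by ring] at this ⊢
    rw [h] at this
    exact this.symm
  have c2 : Nat.Coprime (Nat.fib (m + 1)) (Nat.fib (m + 3)) := by
    have h2 : Nat.fib (m + 3) = Nat.fib (m + 1) + Nat.fib (m + 2) := Nat.fib_add_two
    rw [h2]
    simpa using Nat.fib_coprime_fib_succ (m + 1)
  show Nat.fib (m + 3) * fibFact (m + 2) * fibFact (m + 1) ∣ fibFact (2 * (m + 1))
  apply dvd_of_two_mul (Nat.Coprime.mul_left c1 c2)
  · have := mul_dvd_mul_left (Nat.fib (m + 1)) f3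
    rw [mul_left_comm, ← s1, s3] at this
    rwa [mul_comm (Nat.fib (2 * (m + 1) + 1)), mul_assoc (Nat.fib (m + 1))]
  · rw [mul_assoc]
    exact mul_dvd_mul_left _ hD
end

section
/- For every nonnegative integer n, the Lucas polynomials satisfy the identity {2n}·{n+2} − {2n+2}·{n} = (−1)^n·{2}·t^n·{n} in the polynomial ring ℤ[s,t] (note that {2} = s). -/
open MvPolynomial

theorem lucas_step (n : ℕ) : lucas (n + 2) = X 0 * lucas (n + 1) + X 1 * lucas n := by
  rw [lucas]

theorem lucas_docagne (j k : ℕ) :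
    lucas (k + j) * lucas (k + 1) - lucas (k + j + 1) * lucas k
      = (-1 : MvPolynomial (Fin 2) ℤ) ^ k * (X 1) ^ k * lucas j := by
  induction k with
  | zero => simp [lucas]
  | succ k ih =>
    have e1 : k + 1 + j = k + j + 1 := by omega
    rw [e1, lucas_step (k + j), lucas_step k, pow_succ, pow_succ]
    linear_combination (-X 1) * ih

/-- `{2n}·{n+2} − {2n+2}·{n} = (−1)^n·{2}·t^n·{n}` in `ℤ[s,t]` (note `{2} = s`). -/
theorem lucas_identity (n : ℕ) :
    lucas (2 * n) * lucas (n + 2) - lucas (2 * n + 2) * lucas n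
      = (-1 : MvPolynomial (Fin 2) ℤ) ^ n * lucas 2 * (X 1) ^ n * lucas n := by
  have h := lucas_docagne n n
  have h2 : lucas 2 = X 0 := by simp [lucas]
  rw [h2, lucas_step (2 * n), lucas_step n, two_mul]
  linear_combination (X 0) * h
end

section
/- For every integer n ≥ 1, the Lucas analogue of the generalized FiboCatalan number for r = 1, namely {3}·{2}·{2n}!/({n}!·{n+2}!), is a polynomial with nonnegative integer coefficients; that is, there exists a polynomial p in ℤ[s,t], all of whose coefficients are nonnegative, such that {3}·{2}·{2n}! = p·{n}!·{n+2}!. -/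
open MvPolynomial

namespace LucasAux

lemma lucas_add_two (n : ℕ) : lucas (n+2) = X 0 * lucas (n + 1) + X 1 * lucas n := by
  rw [lucas]

lemma lucasFact_succ (n : ℕ) : lucasFact (n+1) = lucas (n+1) * lucasFact n := by
  rw [lucasFact]

lemma lucas_zero : lucas 0 = 0 := by rw [lucas]
lemma lucas_one : lucas 1 = 1 := by rw [lucas]
lemma lucasFact_zero : lucasFact 0 = 1 := by rw [lucasFact]

lemma lucas_add (m : ℕ) : ∀ n, lucas (m + n + 1) =
    lucas (m+1) * lucas (n+1) + X 1 * lucas m * lucas n ∧ lucas (m + (n+1) + 1) =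
    lucas (m+1) * lucas (n+2) + X 1 * lucas m * lucas (n+1) := by
  intro n
  induction n with
  | zero =>
    constructor
    · simp [lucas_zero, lucas_one]
    · simp [lucas_add_two, lucas_zero, lucas_one]; ring
  | succ n ih =>
    refine ⟨ih.2, ?_⟩
    have e : m + (n + 1 + 1) + 1 = (m + n + 1) + 2 := by ring
    have e' : m + n + 1 + 1 = m + (n+1) + 1 := by ring
    rw [e, lucas_add_two, e', ih.1, ih.2, lucas_add_two (n+1)]
    simp only [lucas_add_two]
    ring

lemma fact_mul_dvd : ∀ k m n, m + n = k → lucasFact m * lucasFact n ∣ lucasFact k := by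
  intro k
  induction k with
  | zero =>
    intro m n h
    obtain ⟨rfl, rfl⟩ : m = 0 ∧ n = 0 := by omega
    simp [lucasFact_zero]
  | succ k ih =>
    intro m n h
    rcases m with _ | m
    · obtain rfl : n = k + 1 := by omega
      simp [lucasFact_zero]
    rcases n with _ | n
    · obtain rfl : m = k := by omega
      simp [lucasFact_zero]
    obtain ⟨u, hu⟩ := ih m (n+1) (by omega)
    obtain ⟨v, hv⟩ := ih (m+1) n (by omega)
    obtain rfl : k = m + 1 + n := by omega
    refine ⟨lucas (n+2) * u + X 1 * lucas m * v, ?_⟩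
    have e := (lucas_add m n).2
    have e' : m + (n+1) + 1 = m + 1 + n + 1 := by ring
    rw [lucasFact_succ, ← e', e, add_mul]
    nth_rewrite 1 [hu]
    rw [hv, lucasFact_succ m, lucasFact_succ n]
    ring

lemma cassini (m : ℕ) : lucas (m+1) ^ 2 - lucas m * lucas (m+2) = (- X 1) ^ m := by
  induction m with
  | zero => simp [lucas_zero, lucas_one]
  | succ m ih =>
    rw [pow_succ (-X 1), ← ih, lucas_add_two (m+1), lucas_add_two m]; ring

lemma eval_lucas (n : ℕ) : eval ![1, 0] (lucas (n+1)) = (1:ℤ) := by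
  induction n with
  | zero => simp [lucas_one]
  | succ n ih => rw [lucas_add_two]; simp [ih]

lemma eval_fact (n : ℕ) : eval ![1, 0] (lucasFact n) = (1:ℤ) := by
  induction n with
  | zero => simp [lucasFact_zero]
  | succ n ih => rw [lucasFact_succ]; simp [ih, eval_lucas]

lemma eval_lucas_pos (n : ℕ) : 0 < eval ![1, 1] (lucas (n+1)) ∧
    (0:ℤ) < eval ![1, 1] (lucas (n+2)) := by
  induction n with
  | zero => simp [lucas_add_two, lucas_one, lucas_zero]
  | succ n ih =>
    refine ⟨ih.2, ?_⟩
    rw [lucas_add_two]; simp; linarith [ih.1, ih.2]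

lemma eval_fact_pos (n : ℕ) : (0:ℤ) < eval ![1, 1] (lucasFact n) := by
  induction n with
  | zero => simp [lucasFact_zero]
  | succ n ih => rw [lucasFact_succ, map_mul]; exact mul_pos (eval_lucas_pos n).1 ih

lemma alg_key {R : Type*} [CommRing R] {s t a b c d N D u1 u2 u3 : R}
    (e3 : d = s * c + t * b) (e2 : c = s * b + t * a)
    (hu1 : N * (c * d) = D * u1) (hu2 : N * (b * d) = D * u2) (hu3 : N * (a * b) = D * u3)
    (w : R) : D ∣ (w * (b ^ 2 - a * c) * (t * (b ^ 2 - a * c)) ^ 2) *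
      ((s ^ 2 + t) * s * N) := by
  -- K = b^2 - a c,  K' = c^2 - b d = - t K
  have k' : t * (b^2 - a * c) = b * d - c^2 := by rw [e3, e2]; ring
  have f1 : s * (c^2 - b*d) = d * (c - s * b) - t * c * b := by rw [e3]; ring
  have f2 : (s^2+t) * (b^2 - a*c) = d * b - a * (s*t*b + (s^2+t)*c) := by
    rw [e3, e2]; ring
  set P := (c - s*b) * (d * b - a * (s*t*b + (s^2+t)*c)) - t * c * b * b with hP
  have f3 : s * (c^2 - b*d) * ((s^2+t) * (b^2 - a*c)) =
      d * P + a * b * (t * c * (s*t*b + (s^2+t)*c)) := by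
    rw [f1, f2, hP]; ring
  have f4 : ((s^2+t) * s * N) * ((b^2 - a*c) * (b * d - c^2)^2) =
      (-(N * (c * d)) * c * P + N * (b * d) * d * P + 
       N * (a * b) * (t * c * (s*t*b + (s^2+t)*c)) * (b*d - c^2)) * (-1)  := by
    linear_combination (-N * (b*d-c^2)) * f3
  rw [hu1, hu2, hu3] at f4
  rw [k']
  refine ⟨w * ((-u1 * c * P + u2 * d * P +
    u3 * (t * c * (s*t*b + (s^2+t)*c)) * (b*d - c^2)) * (-1)), ?_⟩
  linear_combination w * f4

lemma main_dvd (m : ℕ) : lucasFact (m+1) * lucasFact (m+3) ∣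
    lucas 3 * lucas 2 * lucasFact (2 * (m+1)) := by
  set D := lucasFact (m+1) * lucasFact (m+3) with hD
  set N := lucasFact (2 * (m+1)) with hN
  have h1 : D ∣ N * (lucas (m+2) * lucas (m+3)) := by
    obtain ⟨u, hu⟩ := fact_mul_dvd (2*(m+1)) (m+1) (m+1) (by ring)
    refine ⟨u, ?_⟩
    rw [hN, hu, hD, lucasFact_succ (m+2), lucasFact_succ (m+1)]; ring
  have h2 : D ∣ N * (lucas (m+1) * lucas (m+3)) := by
    obtain ⟨u, hu⟩ := fact_mul_dvd (2*(m+1)) m (m+2) (by ring)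
    refine ⟨u, ?_⟩
    rw [hN, hu, hD, lucasFact_succ (m+2), lucasFact_succ m]; ring
  have h3 : D ∣ N * (lucas m * lucas (m+1)) := by
    rcases m with _ | m
    · simp [lucas_zero]
    obtain ⟨u, hu⟩ := fact_mul_dvd (2*(m+1+1)) m (m+4) (by ring)
    refine ⟨u, ?_⟩
    rw [hN, hu, hD, lucasFact_succ (m+1), lucasFact_succ m]; ring
  have key : D ∣ X 1 ^ (3 * m + 2) * (lucas 3 * lucas 2 * N) := by
    have c := cassini m
    have h23 : lucas 3 * lucas 2 = (X 0 ^ 2 + X 1) * X 0 := by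
      simp [lucas_add_two, lucas_one, lucas_zero]; ring
    have hc : X 1 ^ (3 * m + 2) = (-1) ^ m * (lucas (m+1) ^ 2 - lucas m * lucas (m+2)) *
        ((X 1) * (lucas (m+1) ^ 2 - lucas m * lucas (m+2))) ^ 2 := by
      rw [c, neg_pow]
      have : ((-1 : MvPolynomial (Fin 2) ℤ) ^ m) * (-1) ^ m = 1 := by
        rw [← mul_pow]; simp
      calc _ = ((-1 : MvPolynomial (Fin 2) ℤ) ^ m * (-1) ^ m) * ((-1) ^ m * (-1) ^ m)
              * X 1 ^ (3 * m + 2) := by rw [this]; ring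
        _ = _ := by ring
    obtain ⟨u1, hu1⟩ := h1
    obtain ⟨u2, hu2⟩ := h2
    obtain ⟨u3, hu3⟩ := h3
    rw [h23, hc]
    exact alg_key (lucas_add_two (m+1)) (lucas_add_two m) hu1 hu2 hu3 _
  have hp : Prime (X 1 : MvPolynomial (Fin 2) ℤ) := X_prime
  have hrel : IsRelPrime D (X 1 ^ (3*m+2)) := by
    apply IsRelPrime.pow_right
    rw [isRelPrime_comm]
    refine (hp.irreducible.isRelPrime_iff_not_dvd).2 ?_
    rintro ⟨q, hq⟩
    have := congrArg (eval ![1, 0]) hq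
    simp [hD, eval_fact] at this
  exact hrel.dvd_of_dvd_mul_left key

/-- all divisors have coefficients of one sign -/
def Good (f : MvPolynomial (Fin 2) ℝ) : Prop :=
  ∀ p, p ∣ f → (∀ d, 0 ≤ p.coeff d) ∨ (∀ d, 0 ≤ (-p).coeff d)

lemma nn_mul {p q : MvPolynomial (Fin 2) ℝ} (hp : ∀ d, 0 ≤ p.coeff d)
    (hq : ∀ d, 0 ≤ q.coeff d) : ∀ d, 0 ≤ (p * q).coeff d := by
  intro d
  rw [coeff_mul]
  exact Finset.sum_nonneg fun x _ => mul_nonneg (hp _) (hq _)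

lemma Good.mul {f g : MvPolynomial (Fin 2) ℝ} (hf : Good f) (hg : Good g) : Good (f * g) := by
  intro p hp
  obtain ⟨a, b, ha, hb, rfl⟩ := exists_dvd_and_dvd_of_dvd_mul hp
  rcases hf a ha with h | h <;> rcases hg b hb with h' | h'
  · exact Or.inl (nn_mul h h')
  · right; have := nn_mul h h'; rwa [mul_neg] at this
  · right; have := nn_mul h h'; rwa [neg_mul] at this
  · left; have := nn_mul h h'; rwa [neg_mul_neg] at this

lemma Good.of_dvd {f g : MvPolynomial (Fin 2) ℝ} (hf : Good f) (h : g ∣ f) : Good g :=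
  fun p hp => hf p (hp.trans h)

lemma nn_C {c : ℝ} (hc : 0 ≤ c) : ∀ d, 0 ≤ (C c : MvPolynomial (Fin 2) ℝ).coeff d := by
  intro d; rw [coeff_C]; split_ifs <;> simp [hc]

lemma good_unit {f : MvPolynomial (Fin 2) ℝ} (hf : IsUnit f) : Good f := by
  intro p hp
  obtain ⟨c, _, rfl⟩ := isUnit_iff_eq_C_of_isReduced.1 (isUnit_of_dvd_unit hp hf)
  rcases le_total 0 c with h | h
  · exact Or.inl (nn_C h)
  · right
    rw [← C_neg]
    exact nn_C (by linarith)

lemma good_irred {f : MvPolynomial (Fin 2) ℝ} (hf : Irreducible f)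
    (h : ∀ d, 0 ≤ f.coeff d) : Good f := by
  intro p hp
  rcases (hf.dvd_iff).1 hp with hu | ha
  · exact good_unit hu p dvd_rfl
  · obtain ⟨u, rfl⟩ := ha
    rcases good_unit u.isUnit _ dvd_rfl with h' | h'
    · left
      have := nn_mul h h'
      simpa using this
    · right
      have := nn_mul h h'
      simpa using this

lemma nn_X (i : Fin 2) : ∀ d, 0 ≤ (X i : MvPolynomial (Fin 2) ℝ).coeff d := by
  intro d; rw [coeff_X]; split_ifs <;> simp

lemma good_X0 : Good (X 0) :=
  good_irred X_prime.irreducible (nn_X 0)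

lemma good_quad (c : ℝ) (hc : 0 ≤ c) : Good (X 0 ^ 2 + C c * X 1) := by
  rcases hc.eq_or_lt with rfl | hc
  · simpa [sq] using good_X0.mul good_X0
  apply good_irred
  · rw [add_comm]
    apply irreducible_mul_X_add
    · simpa using hc.ne'
    · simp
    · intro h
      have := vars_pow _ _ h
      simp [vars_X] at this
    · apply IsUnit.isRelPrime_left
      simpa using hc.ne'
  · intro d
    rw [coeff_add]
    refine add_nonneg ?_ (nn_mul (nn_C hc.le) (nn_X 1) d)
    rw [sq]
    exact nn_mul (nn_X 0) (nn_X 0) d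

lemma eval_lucas_xy (x y : ℂ) (n : ℕ) :
    (x - y) * eval₂ (Int.castRingHom ℂ) ![x + y, -(x*y)] (lucas n) = x^n - y^n ∧
    (x - y) * eval₂ (Int.castRingHom ℂ) ![x + y, -(x*y)] (lucas (n+1)) = x^(n+1) - y^(n+1) := by
  induction n with
  | zero => simp [lucas_zero, lucas_one]
  | succ n ih =>
    refine ⟨ih.2, ?_⟩
    rw [lucas_add_two]
    simp only [eval₂_add, eval₂_mul, eval₂_X]
    simp only [Matrix.cons_val_zero, Matrix.cons_val_one]
    linear_combination (x + y) * ih.2 - x * y * ih.1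

lemma prod_root (x y ζ : ℂ) (n : ℕ) (hn : 0 < n) (h : IsPrimitiveRoot ζ n) :
    ∏ k ∈ Finset.range n, (x - ζ^k * y) = x^n - y^n := by
  have := congrArg (Polynomial.eval x) (X_pow_sub_C_eq_prod h hn (rfl : y^n = y^n))
  simp [Polynomial.eval_prod] at this
  exact this.symm

lemma factor (n : ℕ) (hn : 0 < n) :
    (X 0 ^ 2 + C 4 * X 1) * (map (Int.castRingHom ℝ) (lucas n)) ^ 2 =
    ∏ k ∈ Finset.range n, (X 0 ^ 2 + C (2 + 2 * Real.cos (2 * Real.pi * k / n)) * X 1) := by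
  apply map_injective (algebraMap ℝ ℂ) (algebraMap ℝ ℂ).injective
  apply MvPolynomial.funext
  intro v
  obtain ⟨x, y, hs, ht⟩ : ∃ x y : ℂ, x + y = v 0 ∧ -(x * y) = v 1 := by
    obtain ⟨r, hr⟩ := IsAlgClosed.exists_pow_nat_eq (v 0 ^ 2 + 4 * v 1) (n := 2) (by norm_num)
    refine ⟨(v 0 + r)/2, (v 0 - r)/2, by ring, ?_⟩
    linear_combination (1/4) * hr
  have hv : v = ![x + y, -(x*y)] := by
    funext i; fin_cases i <;> simp [hs, ht]
  have hζ := Complex.isPrimitiveRoot_exp n hn.ne'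
  set ζ := Complex.exp (2 * Real.pi * Complex.I / n) with hz
  have h1 := prod_root x y ζ n hn hζ
  have h2 := prod_root x y ζ⁻¹ n hn hζ.inv
  have h3 := (eval_lucas_xy x y n).1
  have hl : eval v (map (algebraMap ℝ ℂ) (map (Int.castRingHom ℝ) (lucas n))) =
      eval₂ (Int.castRingHom ℂ) ![x + y, -(x*y)] (lucas n) := by
    rw [map_map, eval_map, hv]
    congr 1
  have hcos : ∀ k : ℕ, ((Real.cos (2 * Real.pi * k / n) : ℝ) : ℂ) * 2 = ζ^k + ζ⁻¹^k := by
    intro k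
    rw [Complex.ofReal_cos, Complex.cos, hz, ← Complex.exp_neg, ← Complex.exp_nat_mul,
      ← Complex.exp_nat_mul]
    have e1 : ((2 * Real.pi * k / n : ℝ) : ℂ) * Complex.I =
      k * (2 * Real.pi * Complex.I / n) := by push_cast; ring
    have e2 : -((2 * Real.pi * k / n : ℝ) : ℂ) * Complex.I =
      k * -(2 * Real.pi * Complex.I / n) := by push_cast; ring
    rw [e1, e2]; ring
  have hfac : ∀ k ∈ Finset.range n, eval v (map (algebraMap ℝ ℂ)
      (X 0 ^ 2 + C (2 + 2 * Real.cos (2 * Real.pi * k / n)) * X 1)) =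
      (x - ζ^k * y) * (x - ζ⁻¹^k * y) := by
    intro k _
    have hi : ζ^k * ζ⁻¹^k = 1 := by
      rw [← mul_pow, mul_inv_cancel₀ (Complex.exp_ne_zero _), one_pow]
    have hc := hcos k
    simp only [map_add, map_mul, map_pow, map_X, map_C, eval_X, eval_C, ← hs, ← ht,
      Complex.coe_algebraMap, map_ofNat]
    linear_combination (-(x*y)) * hc - y^2 * hi
  rw [map_prod, map_prod, Finset.prod_congr rfl hfac, Finset.prod_mul_distrib, h1, h2]
  rw [map_mul, map_mul, map_pow, map_pow, hl]
  simp only [map_add, map_mul, map_pow, map_X, map_C, eval_X, eval_C, ← hs, ← ht, map_ofNat]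
  rw [← h3]
  ring

lemma good_lucas (n : ℕ) (hn : 0 < n) : Good (map (Int.castRingHom ℝ) (lucas n)) := by
  have : Good ((X 0 ^ 2 + C 4 * X 1) * (map (Int.castRingHom ℝ) (lucas n)) ^ 2) := by
    rw [factor n hn]
    refine Finset.prod_induction _ Good (fun _ _ => Good.mul) (good_unit isUnit_one) ?_
    intro k _
    apply good_quad
    linarith [Real.neg_one_le_cos (2 * Real.pi * k / n)]
  exact this.of_dvd (Dvd.dvd.mul_left (dvd_pow_self _ two_ne_zero) _)

lemma good_fact (n : ℕ) : Good (map (Int.castRingHom ℝ) (lucasFact n)) := by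
  induction n with
  | zero => rw [lucasFact_zero, map_one]; exact good_unit isUnit_one
  | succ n ih => rw [lucasFact_succ, map_mul]; exact (good_lucas _ n.succ_pos).mul ih

end LucasAux

open LucasAux

/-- For `n ≥ 1`, the Lucas analogue of the generalized FiboCatalan number for `r = 1`,
namely `{3}·{2}·{2n}!/({n}!·{n+2}!)`, is a polynomial with nonnegative integer
coefficients. -/
theorem lucas_generalizedFiboCatalan_r_one_poly (n : ℕ) (hn : 1 ≤ n) :
    ∃ p : MvPolynomial (Fin 2) ℤ, (∀ d, 0 ≤ p.coeff d) ∧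
      lucas 3 * lucas 2 * lucasFact (2 * n)
        = p * (lucasFact n * lucasFact (n + 2)) := by
  obtain ⟨m, rfl⟩ : ∃ m, n = m + 1 := ⟨n - 1, by omega⟩
  obtain ⟨p, hp⟩ := main_dvd m
  refine ⟨p, ?_, by rw [hp]; ring⟩
  have hg : Good (map (Int.castRingHom ℝ) (lucas 3 * lucas 2 * lucasFact (2 * (m+1)))) := by
    rw [map_mul, map_mul]
    exact ((good_lucas 3 (by norm_num)).mul (good_lucas 2 (by norm_num))).mul (good_fact _)
  rcases hg (map (Int.castRingHom ℝ) p)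
    (by rw [hp, map_mul]; exact Dvd.intro_left _ rfl) with h | h
  · intro d
    have := h d
    rw [coeff_map] at this
    simpa using this
  · exfalso
    have hd : ∀ d, p.coeff d ≤ 0 := by
      intro d
      have := h d
      rw [coeff_neg, coeff_map] at this
      simpa using this
    have e := congrArg (eval ![1, 1]) hp
    simp only [map_mul] at e
    have hle : eval ![1, 1] p ≤ 0 := by
      rw [eval_eq']
      apply Finset.sum_nonpos
      intro d _
      simpa [Fin.prod_univ_two] using hd d
    have a1 := (eval_lucas_pos 2).1
    have a2 := (eval_lucas_pos 1).1
    have a3 := eval_fact_pos (2 * (m+1))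
    have a4 := eval_fact_pos (m+1)
    have a5 := eval_fact_pos (m+3)
    have := mul_pos (mul_pos a1 a2) a3
    have h' := mul_nonpos_of_nonneg_of_nonpos (mul_pos a4 a5).le hle
    rw [← e] at h'
    exact absurd this (not_lt.2 h')
end
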